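/- For i ≠ j, the quantum Serre element u_{ij}^+ = ∑_{k=0}^{1-a_{ij}} (-1)^k binom(1-a_{ij},k)_{q_{ii}} q_{ii}^{k(k-1)/2} q_{ij}^k e_i^{1-a_{ij}-k} e_j e_i^k in the Hopf algebra Ũ_q(g) (defined without Serre relations) is a skew-primitive element: Δ(u_{ij}^+) = u_{ij}^+ ⊗ 1 + ω_i^{1-a_{ij}} ω_j ⊗ u_{ij}^+. -/

import Mathlib

open TensorProduct

/-- The Gaussian binomial coefficient `binom(n,k)_t`, via the Pascal recursion
`binom(n,k)_t = t^k binom(n-1,k)_t + binom(n-1,k-1)_t`. -/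
def qbinom {K : Type*} [Field K] (t : K) : ℕ → ℕ → K
  | _, 0 => 1
  | 0, _ + 1 => 0
  | n + 1, k + 1 => t ^ (k + 1) * qbinom t n (k + 1) + qbinom t n k

/-- The quantum Serre element
`u_{ij}^+ = ∑_{k=0}^{N} (-1)^k binom(N,k)_{q_{ii}} q_{ii}^{k(k-1)/2} q_{ij}^k
e_i^{N-k} e_j e_i^k` with `N = 1 - a_{ij}`. -/
def serrePlus {K H I : Type*} [Field K] [Ring H] [Module K H]
    (qm : I → I → K) (e : I → H) (N : ℕ) (i j : I) : H :=
  ∑ k ∈ Finset.range (N + 1),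
    ((-1 : K) ^ k * qbinom (qm i i) N k * qm i i ^ (k * (k - 1) / 2) * qm i j ^ k) •
      (e i ^ (N - k) * e j * e i ^ k)

/-- `qbinom t n k` vanishes for `k > n`. -/
theorem qbinom_eq_zero_of_lt {K : Type*} [Field K] (t : K) :
    ∀ {n k : ℕ}, n < k → qbinom t n k = 0
  | 0, k + 1, _ => by simp [qbinom]
  | n + 1, k + 1, h => by
    rw [qbinom, qbinom_eq_zero_of_lt t (by omega : n < k + 1),
      qbinom_eq_zero_of_lt t (by omega : n < k)]
    simp

theorem qbinom_zero_right {K : Type*} [Field K] (t : K) (n : ℕ) : qbinom t n 0 = 1 := by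
  cases n <;> rfl

/-- The second Pascal recursion for the Gaussian binomial coefficients. -/
theorem qbinom_succ_succ' {K : Type*} [Field K] (t : K) :
    ∀ {n k : ℕ}, k ≤ n →
      qbinom t (n + 1) (k + 1) = qbinom t n (k + 1) + t ^ (n - k) * qbinom t n k
  | 0, 0, _ => by simp [qbinom]
  | n + 1, 0, _ => by
    have ih := qbinom_succ_succ' t (Nat.zero_le n)
    rw [qbinom, ih]
    simp only [qbinom, qbinom_zero_right] at ih ⊢
    simp only [Nat.sub_zero, pow_succ] at ih ⊢
    linear_combination (t + 1) * ih
  | n + 1, k + 1, h => by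
    rcases Nat.lt_or_ge n (k + 1) with hk | hk
    · obtain rfl : n = k := by omega
      rw [qbinom, qbinom_eq_zero_of_lt t (by omega : n + 1 < n + 1 + 1)]
      simp
    · obtain ⟨d, rfl⟩ := Nat.exists_eq_add_of_le hk
      have h₁ := qbinom_succ_succ' t hk
      have h₂ := qbinom_succ_succ' t (by omega : k ≤ k + 1 + d)
      have h₃ : qbinom t (k + 1 + d + 1) (k + 1 + 1) = t ^ (k + 1 + 1) *
        qbinom t (k + 1 + d) (k + 1 + 1) + qbinom t (k + 1 + d) (k + 1) := rfl
      have h₄ : qbinom t (k + 1 + d + 1) (k + 1) = t ^ (k + 1) *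
        qbinom t (k + 1 + d) (k + 1) + qbinom t (k + 1 + d) k := rfl
      rw [show k + 1 + d - (k + 1) = d by omega] at h₁
      rw [show k + 1 + d - k = d + 1 by omega] at h₂
      rw [qbinom, show k + 1 + d + 1 - (k + 1) = d + 1 by omega]
      linear_combination t ^ (k + 1 + 1) * h₁ + h₂ - h₃ - t ^ (d + 1) * h₄

/-- Regrouping of a sum whose coefficients obey a Pascal-type recursion. -/
theorem Finset.sum_smul_add_smul_succ {R M : Type*} [CommRing R] [AddCommGroup M] [Module R M]
    {c c' α β : ℕ → R} {n : ℕ} (T : ℕ → M) (h_zero : c' 0 = α 0 * c 0)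
    (h_succ : ∀ k ≤ n, c' (k + 1) = α (k + 1) * c (k + 1) + β k * c k)
    (h_top : c (n + 1) = 0) :
    ∑ k ∈ Finset.range (n + 1), c k • (α k • T k + β k • T (k + 1)) =
      ∑ k ∈ Finset.range (n + 1 + 1), c' k • T k := by
  have h₁ : ∑ k ∈ Finset.range (n + 1), c' (k + 1) • T (k + 1) =
      ∑ k ∈ Finset.range (n + 1), (α (k + 1) * c (k + 1)) • T (k + 1) +
        ∑ k ∈ Finset.range (n + 1), (β k * c k) • T (k + 1) := by
    rw [← Finset.sum_add_distrib]
    refine Finset.sum_congr rfl fun k hk => ?_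
    rw [h_succ k (by simpa [Nat.lt_succ_iff] using hk), add_smul]
  have h₂ : ∑ k ∈ Finset.range (n + 1), (α k * c k) • T k =
      ∑ k ∈ Finset.range (n + 1), (α (k + 1) * c (k + 1)) • T (k + 1) + (α 0 * c 0) • T 0 := by
    rw [← Finset.sum_range_succ' (fun k => (α k * c k) • T k), Finset.sum_range_succ _ (n + 1),
      h_top]
    simp
  rw [Finset.sum_range_succ' _ (n + 1), h₁, h_zero, add_right_comm, ← h₂, ← Finset.sum_add_distrib]
  refine Finset.sum_congr rfl fun k _ => ?_
  rw [smul_add, smul_smul, smul_smul, mul_comm (α k), mul_comm (β k)]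

theorem mul_pow_eq_smul_of_mul_eq_smul {R A : Type*} [CommRing R] [Ring A] [Algebra R A]
    {a b : A} {c : R} (h : a * b = c • (b * a)) (n : ℕ) : a * b ^ n = c ^ n • (b ^ n * a) := by
  induction n with
  | zero => simp
  | succ n ih =>
    rw [pow_succ b, ← mul_assoc, ih, smul_mul_assoc, mul_assoc, h, mul_smul_comm, smul_smul,
      ← mul_assoc, pow_succ]

theorem pow_mul_eq_smul_of_mul_eq_smul {R A : Type*} [CommRing R] [Ring A] [Algebra R A]
    {a b : A} {c : R} (h : a * b = c • (b * a)) (n : ℕ) : a ^ n * b = c ^ n • (b * a ^ n) := by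
  induction n with
  | zero => simp
  | succ n ih =>
    rw [pow_succ a, mul_assoc, h, mul_smul_comm, ← mul_assoc, ih, smul_mul_assoc, smul_smul,
      mul_assoc, pow_succ, mul_comm c]

section serrePlus

variable {K H I : Type*} [Field K] [Ring H]

theorem serrePlus_zero [Algebra K H] (qm : I → I → K) (e : I → H) (i j : I) :
    serrePlus qm e 0 i j = e j := by
  simp [serrePlus, qbinom]

/-- Quantum Serre elements are iterated `q`-commutators. -/
theorem serrePlus_succ [Algebra K H] (qm : I → I → K) (e : I → H) (n : ℕ) (i j : I) :
    serrePlus qm e (n + 1) i j = e i * serrePlus qm e n i j -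
      (qm i i ^ n * qm i j) • (serrePlus qm e n i j * e i) := by
  unfold serrePlus
  rw [← Finset.sum_smul_add_smul_succ
    (c := fun k => (-1 : K) ^ k * qbinom (qm i i) n k * qm i i ^ (k * (k - 1) / 2) * qm i j ^ k)
    (α := fun _ => 1) (β := fun _ => -(qm i i ^ n * qm i j))]
  · rw [Finset.mul_sum, Finset.sum_mul, Finset.smul_sum, ← Finset.sum_sub_distrib]
    refine Finset.sum_congr rfl fun k hk => ?_
    have hk : k ≤ n := by simpa [Nat.lt_succ_iff] using hk
    rw [Nat.sub_add_comm hk, Nat.add_sub_add_right, mul_smul_comm, smul_mul_assoc,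
      smul_comm (qm i i ^ n * qm i j), ← smul_sub, one_smul, neg_smul, ← sub_eq_add_neg,
      pow_succ', pow_succ]
    simp only [mul_assoc]
  · simp [qbinom_zero_right]
  · intro k hk
    obtain ⟨d, rfl⟩ := Nat.exists_eq_add_of_le hk
    have hdiv : (k + 1) * (k + 1 - 1) / 2 = k * (k - 1) / 2 + k := by
      rw [← Nat.choose_two_right, ← Nat.choose_two_right, Nat.choose_succ_succ' k 1]
      simp [add_comm]
    rw [qbinom_succ_succ' _ hk, hdiv, Nat.add_sub_cancel_left]
    ring
  · simp [qbinom_eq_zero_of_lt]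

theorem mul_serrePlus [Algebra K H] {qm : I → I → K} {e ω : I → H}
    (hconj : ∀ i j, ω i * e j = qm i j • (e j * ω i)) (n : ℕ) (i j : I) :
    ω i * serrePlus qm e n i j = (qm i i ^ n * qm i j) • (serrePlus qm e n i j * ω i) := by
  induction n with
  | zero => simpa [serrePlus_zero] using hconj i j
  | succ n ih =>
    rw [serrePlus_succ, mul_sub, mul_smul_comm, ← mul_assoc, ← mul_assoc, hconj, ih,
      smul_mul_assoc, smul_mul_assoc, mul_assoc, mul_assoc, ih, hconj, sub_mul, smul_mul_assoc,
      mul_smul_comm, mul_smul_comm, smul_smul, smul_sub, smul_smul, smul_smul, smul_smul]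
    simp only [mul_assoc]
    module

/-- The coefficients in the coproduct of a quantum Serre element. -/
def serreCoeff (t x : K) (n k : ℕ) : K :=
  qbinom t n k * ∏ s ∈ Finset.Ico k n, (1 - t ^ s * x)

theorem serreCoeff_succ_zero (t x : K) (n : ℕ) :
    serreCoeff t x (n + 1) 0 = (1 - t ^ n * x) * serreCoeff t x n 0 := by
  rw [serreCoeff, serreCoeff, Finset.prod_Ico_succ_top (Nat.zero_le n), qbinom_zero_right,
    qbinom_zero_right]
  ring

theorem serreCoeff_succ_succ (t x : K) {n k : ℕ} (hk : k ≤ n) :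
    serreCoeff t x (n + 1) (k + 1) = (1 - t ^ (n + (k + 1)) * x) * serreCoeff t x n (k + 1) +
      t ^ (n - k) * serreCoeff t x n k := by
  have h₁ := qbinom_succ_succ' t hk
  have h₂ : qbinom t (n + 1) (k + 1) = t ^ (k + 1) * qbinom t n (k + 1) + qbinom t n k := rfl
  simp only [serreCoeff]
  rcases hk.eq_or_lt with rfl | hk'
  · rw [qbinom_eq_zero_of_lt t (Nat.lt_succ_self k)] at *
    simp [h₁]
  · rw [Finset.prod_Ico_succ_top hk', Finset.prod_eq_prod_Ico_succ_bot hk']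
    obtain ⟨d, rfl⟩ := Nat.exists_eq_add_of_le hk
    rw [Nat.add_sub_cancel_left] at *
    generalize ∏ s ∈ Finset.Ico (k + 1) (k + d), (1 - t ^ s * x) = P
    linear_combination P * h₁ - P * t ^ (k + d) * x * h₂

/-- The general coproduct formula for the iterated `q`-commutators. -/
theorem comul_serrePlus [Bialgebra K H] {qm : I → I → K} {e ω : I → H}
    (hcomm : ∀ i j, ω i * ω j = ω j * ω i)
    (hconj : ∀ i j, ω i * e j = qm i j • (e j * ω i))
    (hΔe : ∀ i, Coalgebra.comul (R := K) (e i) = e i ⊗ₜ[K] 1 + ω i ⊗ₜ[K] e i)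
    (n : ℕ) (i j : I) :
    Coalgebra.comul (R := K) (serrePlus qm e n i j) = serrePlus qm e n i j ⊗ₜ[K] 1 +
      ∑ k ∈ Finset.range (n + 1), serreCoeff (qm i i) (qm i j * qm j i) n k •
        ((e i ^ (n - k) * (ω i ^ k * ω j)) ⊗ₜ[K] serrePlus qm e k i j) := by
  induction n with
  | zero => simp [serrePlus_zero, serreCoeff, qbinom, hΔe]
  | succ n ih =>
    rw [← Finset.sum_smul_add_smul_succ (c := serreCoeff (qm i i) (qm i j * qm j i) n)
      (α := fun k => 1 - qm i i ^ (n + k) * (qm i j * qm j i)) (β := fun k => qm i i ^ (n - k))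
      _ (serreCoeff_succ_zero _ _ n) (fun k hk => serreCoeff_succ_succ _ _ hk)
      (by simp [serreCoeff, qbinom_eq_zero_of_lt])]
    have key : ∀ k ∈ Finset.range (n + 1),
        (e i ⊗ₜ[K] 1 + ω i ⊗ₜ[K] e i) *
            ((e i ^ (n - k) * (ω i ^ k * ω j)) ⊗ₜ[K] serrePlus qm e k i j) -
          (qm i i ^ n * qm i j) •
            (((e i ^ (n - k) * (ω i ^ k * ω j)) ⊗ₜ[K] serrePlus qm e k i j) *
              (e i ⊗ₜ[K] 1 + ω i ⊗ₜ[K] e i)) =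
        (1 - qm i i ^ (n + k) * (qm i j * qm j i)) •
            ((e i ^ (n + 1 - k) * (ω i ^ k * ω j)) ⊗ₜ[K] serrePlus qm e k i j) +
          qm i i ^ (n - k) • ((e i ^ (n + 1 - (k + 1)) * (ω i ^ (k + 1) * ω j)) ⊗ₜ[K]
            serrePlus qm e (k + 1) i j) := by
      intro k hk
      have hk : k ≤ n := by simpa [Nat.lt_succ_iff] using hk
      obtain ⟨d, rfl⟩ := Nat.exists_eq_add_of_le hk
      have h₁ : e i ^ d * (ω i ^ k * ω j) * e i =
          (qm i i ^ k * qm j i) • (e i ^ (d + 1) * (ω i ^ k * ω j)) := by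
        rw [mul_assoc, mul_assoc, hconj, mul_smul_comm, ← mul_assoc (ω i ^ k),
          pow_mul_eq_smul_of_mul_eq_smul (hconj i i), smul_mul_assoc, mul_smul_comm,
          mul_smul_comm, smul_smul, pow_succ]
        simp only [mul_assoc, mul_comm (qm j i)]
      have h₂ : ω i * (e i ^ d * (ω i ^ k * ω j)) =
          qm i i ^ d • (e i ^ d * (ω i ^ (k + 1) * ω j)) := by
        rw [← mul_assoc, mul_pow_eq_smul_of_mul_eq_smul (hconj i i), smul_mul_assoc, pow_succ']
        simp only [mul_assoc]
      have h₃ : e i ^ d * (ω i ^ k * ω j) * ω i = e i ^ d * (ω i ^ (k + 1) * ω j) := by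
        rw [mul_assoc, mul_assoc, hcomm j i, pow_succ]
        simp only [mul_assoc]
      rw [serrePlus_succ, show k + d - k = d by omega, show k + d + 1 - k = d + 1 by omega,
        show k + d + 1 - (k + 1) = d by omega, add_mul, mul_add]
      simp only [Algebra.TensorProduct.tmul_mul_tmul, one_mul, mul_one]
      rw [h₁, h₂, h₃, ← mul_assoc (e i), ← pow_succ']
      simp only [TensorProduct.tmul_sub, TensorProduct.tmul_smul, ← TensorProduct.smul_tmul']
      module
    have hcancel : (e i ⊗ₜ[K] 1 + ω i ⊗ₜ[K] e i) * (serrePlus qm e n i j ⊗ₜ[K] 1) -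
        (qm i i ^ n * qm i j) •
          ((serrePlus qm e n i j ⊗ₜ[K] 1) * (e i ⊗ₜ[K] 1 + ω i ⊗ₜ[K] e i)) =
        serrePlus qm e (n + 1) i j ⊗ₜ[K] (1 : H) := by
      rw [serrePlus_succ, add_mul, mul_add]
      simp only [Algebra.TensorProduct.tmul_mul_tmul, one_mul, mul_one]
      rw [mul_serrePlus hconj]
      simp only [TensorProduct.sub_tmul, ← TensorProduct.smul_tmul']
      module
    rw [← hcancel, serrePlus_succ, map_sub, map_smul, Bialgebra.comul_mul, Bialgebra.comul_mul,
      ih, hΔe, mul_add _ (_ ⊗ₜ[K] 1), add_mul (_ ⊗ₜ[K] 1) (Finset.sum _ _), smul_add,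
      add_sub_add_comm, Finset.mul_sum, Finset.sum_mul, Finset.smul_sum,
      ← Finset.sum_sub_distrib]
    congr 1
    refine Finset.sum_congr rfl fun k hk => ?_
    rw [← key k hk, mul_smul_comm, smul_mul_assoc, smul_comm (qm i i ^ n * qm i j), ← smul_sub]

end serrePlus

/-- in the Hopf algebra `Ũ_q(g)` defined without Serre relations
(abstracted here as any bialgebra containing elements `e_i` and invertible
commuting group-likes `ω_i` with `Δ(e_i) = e_i ⊗ 1 + ω_i ⊗ e_i` and
`ω_i e_j ω_i^{-1} = q_{ij} e_j`, where `q_{ij}q_{ji} = q_{ii}^{a_{ij}}` for a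
symmetrizable GCM), the quantum Serre element `u_{ij}^+` is skew-primitive:
`Δ(u_{ij}^+) = u_{ij}^+ ⊗ 1 + ω_i^{1-a_{ij}} ω_j ⊗ u_{ij}^+`. -/
theorem serrePlus_skew_primitive {K H I : Type*} [Field K] [Ring H]
    [Bialgebra K H] (a : I → I → ℤ) (qm : I → I → K)
    (hq0 : ∀ i j, qm i j ≠ 0)
    (hrel : ∀ i j, qm i j * qm j i = qm i i ^ (a i j))
    (e ω : I → H) (hωu : ∀ i, IsUnit (ω i))
    (hgl : ∀ i, Coalgebra.comul (R := K) (ω i) = ω i ⊗ₜ[K] ω i)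
    (hcomm : ∀ i j, ω i * ω j = ω j * ω i)
    (hconj : ∀ i j, ω i * e j = qm i j • (e j * ω i))
    (hΔe : ∀ i, Coalgebra.comul (R := K) (e i) = e i ⊗ₜ[K] 1 + ω i ⊗ₜ[K] e i)
    (i j : I) (hij : i ≠ j) (haij : a i j ≤ 0) :
    Coalgebra.comul (R := K) (serrePlus qm e (1 - a i j).toNat i j)
      = serrePlus qm e (1 - a i j).toNat i j ⊗ₜ[K] 1
        + (ω i ^ (1 - a i j).toNat * ω j) ⊗ₜ[K]
            serrePlus qm e (1 - a i j).toNat i j := by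
  have hN : ((1 - a i j).toNat : ℤ) = 1 - a i j := Int.toNat_of_nonneg (by omega)
  obtain ⟨m, hm⟩ : ∃ m, (1 - a i j).toNat = m + 1 :=
    Nat.exists_eq_succ_of_ne_zero (by omega)
  rw [comul_serrePlus hcomm hconj hΔe, hm, Finset.sum_range_succ, Finset.sum_eq_zero, zero_add]
  · congr 1
    have hcoeff : ∀ n, qbinom (qm i i) n n = 1 := by
      intro n
      induction n with
      | zero => rfl
      | succ n ih => rw [qbinom, ih, qbinom_eq_zero_of_lt _ (Nat.lt_succ_self n)]; simp
    simp [serreCoeff, hcoeff]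
  · intro k hk
    have hvanish : 1 - qm i i ^ m * (qm i j * qm j i) = 0 := by
      rw [hrel, ← zpow_natCast, ← zpow_add₀ (hq0 i i), show (m : ℤ) + a i j = 0 by omega]
      simp
    rw [serreCoeff, Finset.prod_Ico_succ_top (by simpa [Nat.lt_succ_iff] using hk), hvanish]
    simp
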